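/- arXiv:2503.05275 — 3 statements merged into one kernel-verified Lean document; each statement's English description precedes it below -/
import Mathlib

section
/- Let k ≥ 3, 1 ≤ ℓ < k/2, 1 ≤ d ≤ k−1, and let n satisfy (k−ℓ) ∣ n. Let H_{k,ℓ} be the k-graph on an n-vertex set V whose edges are exactly the k-subsets of V that intersect a fixed set A ⊆ V with |A| = ⌈n/(2(k−ℓ))⌉ − 1. Then H_{k,ℓ} contains no Hamilton ℓ-cycle, and δ_d(H_{k,ℓ}) = C(n−d, k−d) − C(n−|A|−d, k−d). -/
/-- `H` is a `k`-uniform hypergraph (a `k`-graph) on the vertex set `Fin n`. -/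
def IsKGraph (n k : ℕ) (H : Finset (Finset (Fin n))) : Prop :=
  ∀ e ∈ H, e.card = k

/-- The degree `deg_H(S)` of a vertex set `S` in the `k`-graph `H`: the number of
`(k - |S|)`-sets `T` disjoint from `S` with `S ∪ T ∈ H`. -/
noncomputable def hDeg (n k : ℕ) (H : Finset (Finset (Fin n))) (S : Finset (Fin n)) : ℕ :=
  Nat.card {T : Finset (Fin n) // T.card = k - S.card ∧ Disjoint S T ∧ S ∪ T ∈ H}

/-- The minimum `d`-degree `δ_d(H)` of a `k`-graph `H` on `Fin n`. -/
noncomputable def minDeg (n k d : ℕ) (H : Finset (Finset (Fin n))) : ℕ :=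
  sInf { m : ℕ | ∃ S : Finset (Fin n), S.card = d ∧ hDeg n k H S = m }

/-- `H` contains a Hamilton `ℓ`-cycle: there is a cyclic ordering of all the vertices such
that the `n / (k - ℓ)` segments of `k` consecutive vertices starting at the positions
divisible by `k - ℓ` are all edges of `H` (hence every two consecutive edges share
exactly `ℓ` vertices). -/
def HasHamiltonCycle (n k l : ℕ) (H : Finset (Finset (Fin n))) : Prop :=
  ∃ f : ZMod n → Fin n, Function.Bijective f ∧
    ∀ j < n / (k - l),
      ((Finset.range k).image (fun i => f ((j * (k - l) + i : ℕ) : ZMod n))) ∈ H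

/-- `f` enumerates (the vertices, in order, of) an `ℓ`-path with `t` edges in `H`:
the `j`-th edge consists of the `k` consecutive vertices starting at position `j * (k - ℓ)`,
so every two consecutive edges share exactly `ℓ` vertices. -/
def IsLPath (n k l t : ℕ) (H : Finset (Finset (Fin n))) (f : ℕ → Fin n) : Prop :=
  Set.InjOn f (Set.Iio (t * (k - l) + l)) ∧
  ∀ j < t, ((Finset.range k).image (fun i => f (j * (k - l) + i))) ∈ H

/-- The vertex set of the `ℓ`-path with `t` edges enumerated by `f`. -/
def pathVerts (n k l t : ℕ) (f : ℕ → Fin n) : Finset (Fin n) :=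
  (Finset.range (t * (k - l) + l)).image f

/-- The first `ℓ` vertices (as an ordered `ℓ`-set) of the path enumerated by `f`. -/
def pathBeg (n l : ℕ) (f : ℕ → Fin n) : Fin l → Fin n := fun i => f (i : ℕ)

/-- The last `ℓ` vertices (as an ordered `ℓ`-set) of an `ℓ`-path with `t` edges
enumerated by `f`. -/
def pathEnd (n k l t : ℕ) (f : ℕ → Fin n) : Fin l → Fin n := fun i => f (t * (k - l) + (i : ℕ))

/-- `T` is a reachable set for the pair `{u, v}` (with parameter `i`): there are
vertex-disjoint `ℓ`-paths `P₁, …, Pᵢ` of length two covering exactly `T ∪ {u}` and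
vertex-disjoint `ℓ`-paths `P₁', …, Pᵢ'` of length two covering exactly `T ∪ {v}`,
where `P_j` and `P_j'` have the same (ordered) ends for all `j`. -/
def ReachSet (n k l i : ℕ) (H : Finset (Finset (Fin n))) (u v : Fin n)
    (T : Finset (Fin n)) : Prop :=
  ∃ P P' : Fin i → ℕ → Fin n,
    (∀ j, IsLPath n k l 2 H (P j)) ∧ (∀ j, IsLPath n k l 2 H (P' j)) ∧
    (∀ j j', j ≠ j' → Disjoint (pathVerts n k l 2 (P j)) (pathVerts n k l 2 (P j'))) ∧
    (∀ j j', j ≠ j' → Disjoint (pathVerts n k l 2 (P' j)) (pathVerts n k l 2 (P' j'))) ∧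
    (Finset.univ.biUnion (fun j => pathVerts n k l 2 (P j)) = insert u T) ∧
    (Finset.univ.biUnion (fun j => pathVerts n k l 2 (P' j)) = insert v T) ∧
    (∀ j, pathBeg n l (P j) = pathBeg n l (P' j) ∧
      pathEnd n k l 2 (P j) = pathEnd n k l 2 (P' j))

/-- `u` and `v` are `(β, i)`-reachable in the `k`-graph `H` on `n` vertices: there are at
least `β * n ^ ((2k - ℓ) i - 1)` sets `T` of size `(2k - ℓ) i - 1` that are reachable sets
for `{u, v}`. -/
def Reachable (n k l : ℕ) (H : Finset (Finset (Fin n))) (β : ℝ) (i : ℕ) (u v : Fin n) : Prop :=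
  β * (n : ℝ) ^ ((2 * k - l) * i - 1) ≤
    (Nat.card {T : Finset (Fin n) // T.card = (2 * k - l) * i - 1 ∧
      ReachSet n k l i H u v T} : ℝ)

/-- `H` contains a `Y_{k,2ℓ}`-tiling (vertex-disjoint copies of the `k`-graph consisting of
two edges intersecting in exactly `2ℓ` vertices) covering all but at most `u` vertices. -/
def HasYTilingCover (n l : ℕ) (H : Finset (Finset (Fin n))) (u : ℝ) : Prop :=
  ∃ (m : ℕ) (e₁ e₂ : Fin m → Finset (Fin n)),
    (∀ j, e₁ j ∈ H ∧ e₂ j ∈ H ∧ ((e₁ j) ∩ (e₂ j)).card = 2 * l) ∧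
    (∀ j j', j ≠ j' → Disjoint ((e₁ j) ∪ (e₂ j)) ((e₁ j') ∪ (e₂ j'))) ∧
    (n : ℝ) - ((Finset.univ.biUnion fun j => (e₁ j) ∪ (e₂ j)).card : ℝ) ≤ u

/-- The tiling threshold `t_d^ℓ(k, n, ε)`: the minimum `t` such that every `k`-graph `H`
on `n` vertices with `δ_d(H) ≥ t` contains a `Y_{k,2ℓ}`-tiling covering all but at most
`ε n` vertices. -/
noncomputable def tThreshold (k d l n : ℕ) (ε : ℝ) : ℕ :=
  sInf { t : ℕ | ∀ H : Finset (Finset (Fin n)), IsKGraph n k H →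
    t ≤ minDeg n k d H → HasYTilingCover n l H (ε * n) }

/-- `t(k,d,ℓ) := limsup_{ε → 0⁺} limsup_{n → ∞} t_d^ℓ(k,n,ε) / C(n, k-d)`. -/
noncomputable def tVal (k d l : ℕ) : ℝ :=
  Filter.limsup
    (fun ε : ℝ => Filter.limsup
      (fun n : ℕ => (tThreshold k d l n ε : ℝ) / (n.choose (k - d) : ℝ)) Filter.atTop)
    (nhdsWithin (0 : ℝ) (Set.Ioi (0 : ℝ)))

/-- The Dirac threshold `h_d^ℓ(k, n)`: the smallest `h` such that every `k`-graph `H` on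
`n` vertices with `δ_d(H) ≥ h` contains a Hamilton `ℓ`-cycle. -/
noncomputable def hThreshold (k d l n : ℕ) : ℕ :=
  sInf { h : ℕ | ∀ H : Finset (Finset (Fin n)), IsKGraph n k H →
    h ≤ minDeg n k d H → HasHamiltonCycle n k l H }

/-- `h_d^ℓ(k) := limsup_{n → ∞, (k-ℓ) ∣ n} h_d^ℓ(k,n) / C(n, k-d)`. -/
noncomputable def hVal (k d l : ℕ) : ℝ :=
  Filter.limsup (fun n : ℕ => (hThreshold k d l n : ℝ) / (n.choose (k - d) : ℝ))
    (Filter.atTop ⊓ Filter.principal { m : ℕ | (k - l) ∣ m })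

/-- The generalized binomial coefficient `C(x, r)` for a real `x`. -/
noncomputable def genChoose (x : ℝ) (r : ℕ) : ℝ :=
  (∏ i ∈ Finset.range r, (x - (i : ℝ))) / (r.factorial : ℝ)

/-- The number of sets in the `ε`-robust `r`-shadow `∂_ε^r(G)` of the `K`-graph `G` on
`Fin n`: the number of `(K - r)`-sets lying in more than `ε * n ^ r` edges of `G`. -/
noncomputable def shadowCard (n K r : ℕ) (G : Finset (Finset (Fin n))) (ε : ℝ) : ℕ :=
  Nat.card {F : Finset (Fin n) // F.card = K - r ∧ ε * (n : ℝ) ^ r < (hDeg n K G F : ℝ)}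

/-- `g` is an `S`-absorber, given as a `b`-tuple of distinct vertices avoiding `S`: the
tuple spans a family of `2k - 2ℓ + 1` vertex-disjoint `ℓ`-paths, and there is another
family of `2k - 2ℓ + 1` vertex-disjoint `ℓ`-paths, with the same ordered ends, spanning
the tuple together with `S`. -/
def IsAbsorberTuple (n k l b : ℕ) (H : Finset (Finset (Fin n))) (S : Finset (Fin n))
    (g : Fin b → Fin n) : Prop :=
  Function.Injective g ∧ (∀ i, g i ∉ S) ∧
  ∃ (t t' : Fin (2 * k - 2 * l + 1) → ℕ) (Q Q' : Fin (2 * k - 2 * l + 1) → ℕ → Fin n),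
    (∀ j, IsLPath n k l (t j) H (Q j)) ∧ (∀ j, IsLPath n k l (t' j) H (Q' j)) ∧
    (∀ j j', j ≠ j' → Disjoint (pathVerts n k l (t j) (Q j)) (pathVerts n k l (t j') (Q j'))) ∧
    (∀ j j', j ≠ j' →
      Disjoint (pathVerts n k l (t' j) (Q' j)) (pathVerts n k l (t' j') (Q' j'))) ∧
    (∀ j, pathBeg n l (Q j) = pathBeg n l (Q' j) ∧
      pathEnd n k l (t j) (Q j) = pathEnd n k l (t' j) (Q' j)) ∧
    Finset.univ.biUnion (fun j => pathVerts n k l (t' j) (Q' j)) = Finset.image g Finset.univ ∧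
    Finset.univ.biUnion (fun j => pathVerts n k l (t j) (Q j)) = Finset.image g Finset.univ ∪ S

/-- The `k`-graph of all `k`-subsets of `Fin n` that meet `A`. -/
def meetingGraph (n k : ℕ) (A : Finset (Fin n)) : Finset (Finset (Fin n)) :=
  (Finset.powersetCard k (Finset.univ : Finset (Fin n))).filter (fun e => (e ∩ A).Nonempty)

theorem hDeg_meetingGraph {n k : ℕ} (A S : Finset (Fin n)) (hS : S.card ≤ k) :
    hDeg n k (meetingGraph n k A) S =
      ((Finset.powersetCard (k - S.card) Sᶜ).filter
        (fun T => ((S ∪ T) ∩ A).Nonempty)).card := by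
  rw [hDeg, Nat.subtype_card]
  intro T
  simp only [meetingGraph, Finset.mem_filter, Finset.mem_powersetCard, Finset.subset_univ,
    true_and, le_compl_iff_disjoint_left]
  constructor
  · rintro ⟨⟨h1, h2⟩, h3⟩
    refine ⟨h2, h1, ?_, h3⟩
    rw [Finset.card_union_of_disjoint h1]
    omega
  · rintro ⟨h1, h2, -, h4⟩
    exact ⟨⟨h2, h1⟩, h4⟩

theorem hDeg_meetingGraph_of_not_disjoint {n k : ℕ} {A S : Finset (Fin n)} (hS : S.card ≤ k)
    (hSA : ¬ Disjoint S A) :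
    hDeg n k (meetingGraph n k A) S = (n - S.card).choose (k - S.card) := by
  have hne : (S ∩ A).Nonempty := Finset.not_disjoint_iff_nonempty_inter.1 hSA
  rw [hDeg_meetingGraph A S hS, Finset.filter_true_of_mem, Finset.card_powersetCard,
    Finset.card_compl, Fintype.card_fin]
  intro T _
  exact hne.mono (Finset.inter_subset_inter_right Finset.subset_union_left)

theorem hDeg_meetingGraph_of_disjoint {n k : ℕ} {A S : Finset (Fin n)} (hS : S.card ≤ k)
    (hSA : Disjoint S A) :
    hDeg n k (meetingGraph n k A) S =
      (n - S.card).choose (k - S.card) - (n - A.card - S.card).choose (k - S.card) := by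
  have hmiss : (Finset.powersetCard (k - S.card) Sᶜ).filter
      (fun T => ¬ ((S ∪ T) ∩ A).Nonempty) = Finset.powersetCard (k - S.card) (A ∪ S)ᶜ := by
    ext T
    simp only [Finset.mem_filter, Finset.mem_powersetCard, Finset.not_nonempty_iff_eq_empty,
      ← Finset.disjoint_iff_inter_eq_empty, Finset.disjoint_union_left,
      Finset.compl_union, Finset.subset_inter_iff, le_compl_iff_disjoint_right]
    tauto
  have hsum := Finset.card_filter_add_card_filter_not (s := Finset.powersetCard (k - S.card) Sᶜ)
    (fun T => ((S ∪ T) ∩ A).Nonempty)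
  rw [hmiss, Finset.card_powersetCard, Finset.card_powersetCard, Finset.card_compl,
    Finset.card_compl, Fintype.card_fin, Finset.card_union_of_disjoint hSA.symm,
    ← Nat.sub_sub] at hsum
  rw [hDeg_meetingGraph A S hS]
  omega

theorem minDeg_meetingGraph {n k d : ℕ} (A : Finset (Fin n)) (hdk : d < k) :
    minDeg n k d (meetingGraph n k A) =
      (n - d).choose (k - d) - (n - A.card - d).choose (k - d) := by
  have hchoose : Nat.choose 0 (k - d) = 0 := Nat.choose_eq_zero_of_lt (by omega)
  have hA : A.card ≤ n := by simpa using A.card_le_univ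
  have hlower : ∀ S : Finset (Fin n), S.card = d →
      (n - d).choose (k - d) - (n - A.card - d).choose (k - d) ≤
        hDeg n k (meetingGraph n k A) S := by
    rintro S rfl
    by_cases hSA : Disjoint S A
    · exact (hDeg_meetingGraph_of_disjoint hdk.le hSA).ge
    · exact (Nat.sub_le _ _).trans (hDeg_meetingGraph_of_not_disjoint hdk.le hSA).ge
  have hattained : d ≤ n → ∃ S : Finset (Fin n), S.card = d ∧
      hDeg n k (meetingGraph n k A) S =
        (n - d).choose (k - d) - (n - A.card - d).choose (k - d) := by
    intro hdn
    by_cases hcase : d ≤ n - A.card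
    · obtain ⟨S, hSA, rfl⟩ := Finset.exists_subset_card_eq (s := Aᶜ) (n := d)
        (by simpa [Finset.card_compl] using hcase)
      exact ⟨S, rfl, hDeg_meetingGraph_of_disjoint hdk.le (le_compl_iff_disjoint_right.1 hSA)⟩
    · obtain ⟨S, -, rfl⟩ := Finset.exists_subset_card_eq (s := (Finset.univ : Finset (Fin n)))
        (n := d) (by simpa using hdn)
      refine ⟨S, rfl, ?_⟩
      rw [hDeg_meetingGraph_of_not_disjoint hdk.le, show n - A.card - S.card = 0 by omega,
        hchoose, Nat.sub_zero]
      intro hSA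
      have := (S ∪ A).card_le_univ
      rw [Finset.card_union_of_disjoint hSA, Fintype.card_fin] at this
      omega
  rcases le_or_gt d n with hdn | hdn
  · obtain ⟨S, hS, hdeg⟩ := hattained hdn
    apply le_antisymm
    · exact Nat.sInf_le ⟨S, hS, hdeg⟩
    · refine le_csInf ⟨_, S, hS, rfl⟩ ?_
      rintro m ⟨S', hS', rfl⟩
      exact hlower S' hS'
  · rw [show n - d = 0 by omega, hchoose, Nat.zero_sub, minDeg]
    convert Nat.sInf_empty
    refine Set.eq_empty_of_forall_notMem ?_
    rintro m ⟨S, hS, -⟩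
    have := S.card_le_univ
    rw [Fintype.card_fin] at this
    omega

/-- A set meeting every edge of a Hamilton `l`-cycle with `l < k / 2` contains at least half as
many vertices as the cycle has edges. -/
theorem not_hasHamiltonCycle_meetingGraph {n k l : ℕ} (hlk : 2 * l < k) (hn : 0 < n)
    (hdiv : (k - l) ∣ n) {A : Finset (Fin n)} (hA : 2 * A.card < n / (k - l)) :
    ¬ HasHamiltonCycle n k l (meetingGraph n k A) := by
  rintro ⟨f, hf, hedge⟩
  obtain ⟨s, hs⟩ : ∃ s, s = k - l := ⟨_, rfl⟩
  rw [← hs] at hdiv hA hedge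
  obtain ⟨m, rfl⟩ := hdiv
  have hs0 : 0 < s := by omega
  rw [Nat.mul_div_cancel_left m hs0] at hA hedge
  have hm : 0 < m := by omega
  let e := Equiv.ofBijective f hf
  let q : Fin (s * m) → ℕ := fun a => (e.symm a).val / s
  have hcover : Finset.range m ⊆ A.biUnion (fun a => {q a, (q a + m - 1) % m}) := by
    intro j hj
    rw [Finset.mem_range] at hj
    obtain ⟨a, ha⟩ := (Finset.mem_filter.1 (hedge j hj)).2
    rw [Finset.mem_inter, Finset.mem_image] at ha
    obtain ⟨⟨i, hi, rfl⟩, haA⟩ := ha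
    rw [Finset.mem_range] at hi
    refine Finset.mem_biUnion.2 ⟨_, haA, ?_⟩
    have hq : q (f ((j * s + i : ℕ) : ZMod (s * m))) = (j + i / s) % m := by
      have : e.symm (f ((j * s + i : ℕ) : ZMod (s * m))) = ((j * s + i : ℕ) : ZMod (s * m)) :=
        e.symm_apply_apply _
      simp only [q]
      rw [this, ZMod.val_natCast, Nat.mod_mul_right_div_self, Nat.add_comm (j * s),
        Nat.add_mul_div_right _ _ hs0, Nat.add_comm j]
    have hi2 : i / s < 2 := (Nat.div_lt_iff_lt_mul hs0).2 (by omega)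
    rw [hq, Finset.mem_insert, Finset.mem_singleton]
    rcases Nat.le_one_iff_eq_zero_or_eq_one.1 (Nat.lt_succ_iff.1 hi2) with h | h <;> rw [h]
    · left
      exact (Nat.mod_eq_of_lt hj).symm
    · right
      rcases (by omega : j + 1 < m ∨ j + 1 = m) with h' | h'
      · rw [Nat.mod_eq_of_lt h', show j + 1 + m - 1 = j + m by omega, Nat.add_mod_right,
          Nat.mod_eq_of_lt hj]
      · rw [h', Nat.mod_self, Nat.zero_add, Nat.mod_eq_of_lt (by omega)]
        omega
  have hcard := (Finset.card_le_card hcover).trans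
    (Finset.card_biUnion_le_card_mul A _ 2 fun a _ => Finset.card_le_two)
  rw [Finset.card_range] at hcard
  omega

/-- The space-barrier construction `H_{k,ℓ}`: all `k`-sets meeting a fixed
set `A` of size `⌈n/(2(k-ℓ))⌉ - 1` form a `k`-graph with no Hamilton `ℓ`-cycle and with
`δ_d = C(n-d, k-d) - C(n-|A|-d, k-d)`. -/
theorem space_barrier (k l d n : ℕ) (hk : 3 ≤ k) (hl : 1 ≤ l) (hlk : 2 * l < k)
    (hd1 : 1 ≤ d) (hdk : d ≤ k - 1) (hdiv : (k - l) ∣ n)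
    (A : Finset (Fin n)) (hA : A.card = ⌈(n : ℚ) / ((2 * (k - l) : ℕ) : ℚ)⌉₊ - 1) :
    ¬ HasHamiltonCycle n k l
        ((Finset.powersetCard k (Finset.univ : Finset (Fin n))).filter
          (fun e => (e ∩ A).Nonempty)) ∧
    minDeg n k d
        ((Finset.powersetCard k (Finset.univ : Finset (Fin n))).filter
          (fun e => (e ∩ A).Nonempty)) =
      (n - d).choose (k - d) - (n - A.card - d).choose (k - d) := by
  refine ⟨?_, minDeg_meetingGraph A (by omega)⟩
  rcases Nat.eq_zero_or_pos n with rfl | hn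
  · rintro ⟨f, -⟩
    exact (f 0).elim0
  · refine not_hasHamiltonCycle_meetingGraph hlk hn hdiv ?_
    have hs0 : 0 < k - l := by omega
    obtain ⟨m, hm⟩ := hdiv
    have hm0 : 0 < m := Nat.pos_of_ne_zero (by rintro rfl; omega)
    have hquot : (n : ℚ) / ((2 * (k - l) : ℕ) : ℚ) = (m : ℚ) / 2 := by
      have : ((k - l : ℕ) : ℚ) ≠ 0 := by exact_mod_cast hs0.ne'
      rw [hm, Nat.cast_mul, Nat.cast_mul]
      field_simp
      norm_num
    have hlt : A.card < ⌈(m : ℚ) / 2⌉₊ := by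
      have : 0 < ⌈(m : ℚ) / 2⌉₊ := Nat.ceil_pos.2 (by positivity)
      rw [hA, hquot]
      omega
    rw [Nat.lt_ceil, lt_div_iff₀ (by norm_num)] at hlt
    rw [Nat.div_eq_of_eq_mul_right hs0 hm, Nat.mul_comm]
    exact_mod_cast hlt
end

section
/- For all integers k ≥ 3, 1 ≤ ℓ < k/2 and 1 ≤ d ≤ k−1, one has t(k,d,ℓ) ≥ 1 − (1 − 1/(2(k−ℓ)))^{k−d}. In particular, for every ε' > 0 and every sufficiently small ε > 0 there exist arbitrarily large n and a k-graph H on n vertices with δ_d(H) ≥ (1 − (1 − 1/(2(k−ℓ)))^{k−d} − ε')·C(n,k−d) that contains no Y_{k,2ℓ}-tiling covering all but at most εn vertices. -/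
open Filter Topology

/-- The `k`-graph on `Fin n` whose edges are all `k`-sets intersecting `A`. -/
def hittingGraph (n k : ℕ) (A : Finset (Fin n)) : Finset (Finset (Fin n)) :=
  (Finset.powersetCard k Finset.univ).filter fun e => ¬ Disjoint e A

lemma mem_hittingGraph {n k : ℕ} {A e : Finset (Fin n)} :
    e ∈ hittingGraph n k A ↔ e.card = k ∧ ¬ Disjoint e A := by
  simp [hittingGraph, Finset.mem_powersetCard]

lemma isKGraph_hittingGraph (n k : ℕ) (A : Finset (Fin n)) :
    IsKGraph n k (hittingGraph n k A) :=
  fun _ he => (mem_hittingGraph.1 he).1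

lemma choose_le_hDeg_hittingGraph_add {n k : ℕ} (A S : Finset (Fin n)) (hS : S.card ≤ k) :
    (n - S.card).choose (k - S.card) ≤
      hDeg n k (hittingGraph n k A) S + (n - A.card).choose (k - S.card) := by
  classical
  have hdeg : hDeg n k (hittingGraph n k A) S = (Finset.univ.filter fun T : Finset (Fin n) =>
      T.card = k - S.card ∧ Disjoint S T ∧ S ∪ T ∈ hittingGraph n k A).card := by
    rw [hDeg, Nat.card_eq_fintype_card, Fintype.card_subtype]
  have hsub : Finset.powersetCard (k - S.card) Sᶜ ⊆
      (Finset.univ.filter fun T : Finset (Fin n) =>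
        T.card = k - S.card ∧ Disjoint S T ∧ S ∪ T ∈ hittingGraph n k A) ∪
      Finset.powersetCard (k - S.card) Aᶜ := by
    intro T hT
    obtain ⟨hTS, hTc⟩ := Finset.mem_powersetCard.1 hT
    have hST : Disjoint S T := (Finset.subset_compl_iff_disjoint_left.1 hTS)
    rw [Finset.mem_union, Finset.mem_powersetCard, Finset.mem_filter]
    by_cases hA : Disjoint T A
    · exact Or.inr ⟨Finset.subset_compl_iff_disjoint_right.2 hA, hTc⟩
    · refine Or.inl ⟨Finset.mem_univ _, hTc, hST, mem_hittingGraph.2 ⟨?_, fun h => hA ?_⟩⟩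
      · rw [Finset.card_union_of_disjoint hST, hTc]
        omega
      · exact h.mono_left Finset.subset_union_right
  have h := (Finset.card_le_card hsub).trans (Finset.card_union_le _ _)
  simpa [hdeg, Finset.card_powersetCard, Finset.card_compl] using h

lemma choose_le_minDeg_hittingGraph_add {n k d : ℕ} (A : Finset (Fin n)) (hdk : d ≤ k)
    (hdn : d ≤ n) :
    (n - d).choose (k - d) ≤
      minDeg n k d (hittingGraph n k A) + (n - A.card).choose (k - d) := by
  obtain ⟨S₀, -, hS₀⟩ := Finset.exists_subset_card_eq
    (s := (Finset.univ : Finset (Fin n))) (n := d) (by simpa using hdn)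
  obtain ⟨S, hS, hm⟩ := Nat.sInf_mem (s := { m : ℕ | ∃ S : Finset (Fin n), S.card = d ∧
    hDeg n k (hittingGraph n k A) S = m }) ⟨_, S₀, hS₀, rfl⟩
  rw [minDeg, ← hm, ← hS]
  exact choose_le_hDeg_hittingGraph_add A S (hS ▸ hdk)

/-- Every tile meets `A`, so a tiling has at most `|A|` tiles of `2 (k - l)` vertices each. -/
lemma not_hasYTilingCover_hittingGraph {n k l : ℕ} (A : Finset (Fin n)) {u : ℝ}
    (hu : u < (n : ℝ) - ((2 * (k - l) * A.card : ℕ) : ℝ)) :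
    ¬ HasYTilingCover n l (hittingGraph n k A) u := by
  classical
  rintro ⟨m, e₁, e₂, he, hdisj, hcov⟩
  have hx : ∀ j, ∃ x, x ∈ e₁ j ∧ x ∈ A := fun j =>
    Finset.not_disjoint_iff.1 (mem_hittingGraph.1 (he j).1).2
  choose x hx₁ hxA using hx
  have hinj : Function.Injective x := by
    intro i j hij
    by_contra hne
    refine Finset.disjoint_left.1 (hdisj i j hne) (Finset.mem_union_left _ (hx₁ i)) ?_
    rw [hij]
    exact Finset.mem_union_left _ (hx₁ j)
  have hm : m ≤ A.card := by
    simpa using Finset.card_le_card_of_injOn (s := (Finset.univ : Finset (Fin m))) x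
      (fun j _ => hxA j) hinj.injOn
  have hcard : ∀ j, (e₁ j ∪ e₂ j).card ≤ 2 * (k - l) := by
    intro j
    have h₁ := (mem_hittingGraph.1 (he j).1).1
    have h₂ := (mem_hittingGraph.1 (he j).2.1).1
    have h := Finset.card_union_add_card_inter (e₁ j) (e₂ j)
    rw [(he j).2.2] at h
    omega
  have hU : (Finset.univ.biUnion fun j => e₁ j ∪ e₂ j).card ≤ 2 * (k - l) * A.card := by
    calc _ ≤ ∑ j, (e₁ j ∪ e₂ j).card := Finset.card_biUnion_le
      _ ≤ ∑ _j : Fin m, 2 * (k - l) := Finset.sum_le_sum fun j _ => hcard j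
      _ = 2 * (k - l) * m := by simp [mul_comm]
      _ ≤ _ := Nat.mul_le_mul_left _ hm
  have hU' : ((Finset.univ.biUnion fun j => e₁ j ∪ e₂ j).card : ℝ) ≤
    ((2 * (k - l) * A.card : ℕ) : ℝ) := by exact_mod_cast hU
  linarith

/-- If `a n ~ α n`, the proportion of `r`-sets avoiding `d` fixed vertices and meeting a set of
`a n` vertices is asymptotically at least `1 - (1 - α) ^ r`. -/
lemma eventually_mul_choose_le_choose_sub_choose {a : ℕ → ℕ} {α c : ℝ} (d r : ℕ)
    (ha : Tendsto (fun n => (a n : ℝ) / n) atTop (𝓝 α)) (han : ∀ n, a n ≤ n)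
    (hc0 : 0 ≤ c) (hc : c < 1 - (1 - α) ^ r) :
    ∀ᶠ n : ℕ in atTop, c * (n.choose r : ℝ) ≤
      ((n - d).choose r : ℝ) - ((n - a n).choose r : ℝ) := by
  have hdr : Tendsto (fun n : ℕ => ((d + r : ℕ) : ℝ) / n) atTop (𝓝 0) :=
    tendsto_const_div_atTop_nhds_zero_nat _
  have hlim : Tendsto (fun n : ℕ => (1 - ((d + r : ℕ) : ℝ) / n) ^ r - (1 - (a n : ℝ) / n) ^ r)
      atTop (𝓝 (1 - (1 - α) ^ r)) := by
    have := ((hdr.const_sub 1).pow r).sub ((ha.const_sub 1).pow r)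
    simpa using this
  filter_upwards [hlim.eventually (lt_mem_nhds hc), eventually_ge_atTop (d + r + 1)] with n hn hnd
  have hn0 : (0 : ℝ) < n := by exact_mod_cast (by omega : 0 < n)
  have hf : (0 : ℝ) < r.factorial := by exact_mod_cast r.factorial_pos
  have h₁ : (n.choose r : ℝ) ≤ (n : ℝ) ^ r / r.factorial := Nat.choose_le_pow_div r n
  have h₂ : ((n - a n).choose r : ℝ) ≤ ((n : ℝ) - a n) ^ r / r.factorial := by
    simpa [Nat.cast_sub (han n)] using Nat.choose_le_pow_div (α := ℝ) r (n - a n)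
  have h₃ : ((n : ℝ) - (d + r : ℕ)) ^ r / r.factorial ≤ ((n - d).choose r : ℝ) := by
    rw [div_le_iff₀ hf, ← Nat.cast_sub (by omega)]
    have h : (n - (d + r)) ^ r ≤ (n - d).descFactorial r :=
      (Nat.pow_le_pow_left (by omega) r).trans (Nat.pow_sub_le_descFactorial (n - d) r)
    rw [Nat.descFactorial_eq_factorial_mul_choose, mul_comm] at h
    exact_mod_cast h
  have hmain : c * (n : ℝ) ^ r ≤ ((n : ℝ) - (d + r : ℕ)) ^ r - ((n : ℝ) - a n) ^ r := by
    have h := mul_le_mul_of_nonneg_right hn.le (pow_nonneg hn0.le r)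
    rw [sub_mul, ← mul_pow, ← mul_pow, sub_mul, sub_mul, div_mul_cancel₀ _ hn0.ne',
      div_mul_cancel₀ _ hn0.ne', one_mul] at h
    exact h
  have hmain' : c * ((n : ℝ) ^ r / r.factorial) ≤
      ((n - d).choose r : ℝ) - ((n - a n).choose r : ℝ) := by
    have h := div_le_div_of_nonneg_right hmain hf.le
    rw [sub_div, mul_div_assoc] at h
    linarith
  exact (mul_le_mul_of_nonneg_left h₁ hc0).trans hmain'

lemma minDeg_le_choose {n k d : ℕ} (H : Finset (Finset (Fin n))) :
    minDeg n k d H ≤ n.choose (k - d) := by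
  classical
  rcases Set.eq_empty_or_nonempty { m : ℕ | ∃ S : Finset (Fin n), S.card = d ∧
    hDeg n k H S = m } with h | h
  · rw [minDeg, h, Nat.sInf_empty]
    exact Nat.zero_le _
  · obtain ⟨S, hS, hm⟩ := Nat.sInf_mem h
    rw [minDeg, ← hm, hDeg, Nat.card_eq_fintype_card, Fintype.card_subtype]
    calc _ ≤ (Finset.powersetCard (k - d) (Finset.univ : Finset (Fin n))).card :=
          Finset.card_le_card fun T hT => Finset.mem_powersetCard.2
            ⟨Finset.subset_univ _, hS ▸ (Finset.mem_filter.1 hT).2.1⟩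
      _ = _ := by simp

lemma minDeg_lt_tThreshold {n k d l : ℕ} {ε : ℝ} {H : Finset (Finset (Fin n))}
    (hH : IsKGraph n k H) (hcov : ¬ HasYTilingCover n l H (ε * n)) :
    minDeg n k d H < tThreshold k d l n ε := by
  have hne : { t : ℕ | ∀ H : Finset (Finset (Fin n)), IsKGraph n k H →
      t ≤ minDeg n k d H → HasYTilingCover n l H (ε * n) }.Nonempty :=
    ⟨n.choose (k - d) + 1, fun H _ h => absurd h (by have := minDeg_le_choose (k := k) (d := d) H; omega)⟩
  by_contra! h
  exact hcov (Nat.sInf_mem hne H hH h)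

lemma tThreshold_le_choose_add_one {n k d l : ℕ} (ε : ℝ) :
    tThreshold k d l n ε ≤ n.choose (k - d) + 1 :=
  Nat.sInf_le fun H _ h => absurd h (by have := minDeg_le_choose (k := k) (d := d) H; omega)

lemma tThreshold_div_choose_le_two (k d l : ℕ) (ε : ℝ) :
    ∀ᶠ n : ℕ in atTop, (tThreshold k d l n ε : ℝ) / (n.choose (k - d) : ℝ) ≤ 2 := by
  filter_upwards [eventually_ge_atTop (k - d)] with n hn
  have hpos : 1 ≤ n.choose (k - d) := Nat.choose_pos hn
  have h : tThreshold k d l n ε ≤ 2 * n.choose (k - d) :=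
    (tThreshold_le_choose_add_one ε).trans (by omega)
  rw [div_le_iff₀ (by exact_mod_cast hpos)]
  exact_mod_cast h

lemma limsup_tThreshold_le_two (k d l : ℕ) (ε : ℝ) :
    limsup (fun n : ℕ => (tThreshold k d l n ε : ℝ) / (n.choose (k - d) : ℝ)) atTop ≤ 2 :=
  limsup_le_of_le (isCoboundedUnder_le_of_le atTop (x := 0) fun n => by positivity)
    (tThreshold_div_choose_le_two k d l ε)

/-- The extremal graphs: a lower bound on degrees valid for all small `ε` and all large `n`. -/
lemma exists_kGraph_not_hasYTilingCover {k l d : ℕ} (hlk : l < k) (hdk : d ≤ k)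
    {ε' : ℝ} (hε' : 0 < ε') :
    ∃ ε₀ : ℝ, 0 < ε₀ ∧ ∀ ε : ℝ, ε ≤ ε₀ → ∀ᶠ n : ℕ in atTop,
      ∃ H : Finset (Finset (Fin n)), IsKGraph n k H ∧
        (1 - (1 - 1 / (2 * ((k : ℝ) - (l : ℝ)))) ^ (k - d) - ε') * (n.choose (k - d) : ℝ) ≤
          (minDeg n k d H : ℝ) ∧
        ¬ HasYTilingCover n l H (ε * n) := by
  set r := k - d
  set w : ℝ := 2 * ((k : ℝ) - (l : ℝ)) with hw
  have hkl : (l : ℝ) + 1 ≤ k := by exact_mod_cast hlk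
  have hw2 : 2 ≤ w := by linarith
  have hwnat : ((2 * (k - l) : ℕ) : ℝ) = w := by
    rw [Nat.cast_mul, Nat.cast_sub hlk.le, hw, Nat.cast_ofNat]
  obtain ⟨ε₀, hdeg, hε₀, hε₁⟩ : ∃ ε₀ : ℝ,
      (1 - (1 - 1 / w) ^ r - ε' < 1 - (1 - (1 - 2 * ε₀) / w) ^ r) ∧ 0 < ε₀ ∧ ε₀ < 1 / 2 := by
    have hcont : Continuous fun x : ℝ => 1 - (1 - (1 - 2 * x) / w) ^ r := by fun_prop
    have hev : ∀ᶠ x in 𝓝 (0 : ℝ), 1 - (1 - 1 / w) ^ r - ε' < 1 - (1 - (1 - 2 * x) / w) ^ r :=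
      hcont.continuousAt.eventually (lt_mem_nhds (by simpa using hε'))
    exact ((hev.filter_mono nhdsWithin_le_nhds).and
      (Ioo_mem_nhdsGT (by norm_num : (0 : ℝ) < 1 / 2))).exists
  refine ⟨ε₀, hε₀, fun ε hε => ?_⟩
  set α : ℝ := (1 - 2 * ε₀) / w with hα
  have hα0 : 0 ≤ α := div_nonneg (by linarith) (by linarith)
  have hα1 : α ≤ 1 := (div_le_one (by linarith)).2 (by linarith)
  have hle : ∀ n : ℕ, (⌊α * n⌋₊ : ℝ) ≤ α * n := fun n => Nat.floor_le (by positivity)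
  have han : ∀ n : ℕ, ⌊α * n⌋₊ ≤ n := fun n => by
    have := (hle n).trans (mul_le_of_le_one_left n.cast_nonneg hα1)
    exact_mod_cast this
  have ha : Tendsto (fun n : ℕ => (⌊α * n⌋₊ : ℝ) / n) atTop (𝓝 α) :=
    (tendsto_nat_floor_mul_div_atTop hα0).comp tendsto_natCast_atTop_atTop
  have hpow : (1 - α) ^ r ≤ 1 := pow_le_one₀ (by linarith) (by linarith)
  have hchoose : ∀ᶠ n : ℕ in atTop, (1 - (1 - 1 / w) ^ r - ε') * (n.choose r : ℝ) ≤
      max 0 (((n - d).choose r : ℝ) - ((n - ⌊α * n⌋₊).choose r : ℝ)) := by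
    rcases lt_or_ge (1 - (1 - 1 / w) ^ r - ε') 0 with hneg | hnn
    · exact Eventually.of_forall fun n =>
        (mul_nonpos_of_nonpos_of_nonneg hneg.le (Nat.cast_nonneg _)).trans (le_max_left _ _)
    · exact (eventually_mul_choose_le_choose_sub_choose d r ha han hnn hdeg).mono
        fun n hn => hn.trans (le_max_right _ _)
  filter_upwards [hchoose, eventually_ge_atTop (d + 1)] with n hn hnd
  have hn0 : (0 : ℝ) < n := by exact_mod_cast (by omega : 0 < n)
  obtain ⟨A, -, hA⟩ := Finset.exists_subset_card_eq
    (s := (Finset.univ : Finset (Fin n))) (n := ⌊α * n⌋₊) (by simpa using han n)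
  refine ⟨hittingGraph n k A, isKGraph_hittingGraph n k A, hn.trans (max_le (by positivity) ?_),
    not_hasYTilingCover_hittingGraph A ?_⟩
  · rw [sub_le_iff_le_add, ← hA]
    exact_mod_cast choose_le_minDeg_hittingGraph_add A hdk (by omega)
  · rw [Nat.cast_mul, hwnat, hA]
    have h₁ : w * (⌊α * n⌋₊ : ℝ) ≤ (1 - 2 * ε₀) * n := by
      calc w * (⌊α * n⌋₊ : ℝ) ≤ w * (α * n) := by gcongr; exact hle n
        _ = (1 - 2 * ε₀) * n := by rw [hα]; field_simp
    nlinarith [mul_le_mul_of_nonneg_right hε hn0.le, mul_pos hε₀ hn0]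

/-- `t(k,d,ℓ) ≥ 1 - (1 - 1/(2(k-ℓ)))^{k-d}`; in particular, for every
`ε' > 0` and every sufficiently small `ε > 0` there are arbitrarily large `n` and
`k`-graphs `H` on `n` vertices with `δ_d(H) ≥ (1 - (1 - 1/(2(k-ℓ)))^{k-d} - ε') C(n,k-d)`
and no `Y_{k,2ℓ}`-tiling covering all but at most `ε n` vertices. -/
theorem tiling_lower_bound (k l d : ℕ) (hk : 3 ≤ k) (hl : 1 ≤ l) (hlk : 2 * l < k)
    (hd1 : 1 ≤ d) (hdk : d ≤ k - 1) :
    1 - (1 - 1 / (2 * ((k : ℝ) - (l : ℝ)))) ^ (k - d) ≤ tVal k d l ∧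
    ∀ ε' : ℝ, 0 < ε' → ∃ ε₀ : ℝ, 0 < ε₀ ∧ ∀ ε : ℝ, 0 < ε → ε ≤ ε₀ →
      ∀ N : ℕ, ∃ n : ℕ, N ≤ n ∧ ∃ H : Finset (Finset (Fin n)), IsKGraph n k H ∧
        (1 - (1 - 1 / (2 * ((k : ℝ) - (l : ℝ)))) ^ (k - d) - ε') * (n.choose (k - d) : ℝ) ≤
          (minDeg n k d H : ℝ) ∧
        ¬ HasYTilingCover n l H (ε * n) := by
  have hd : d ≤ k := by omega
  refine ⟨le_of_forall_sub_le fun ε' hε' => ?_, fun ε' hε' => ?_⟩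
  · obtain ⟨ε₀, hε₀, h⟩ := exists_kGraph_not_hasYTilingCover (l := l) (by omega) hd hε'
    have hev : ∀ᶠ ε : ℝ in 𝓝[>] 0,
        1 - (1 - 1 / (2 * ((k : ℝ) - (l : ℝ)))) ^ (k - d) - ε' ≤
          limsup (fun n : ℕ => (tThreshold k d l n ε : ℝ) / (n.choose (k - d) : ℝ)) atTop := by
      filter_upwards [Ioc_mem_nhdsGT hε₀] with ε hε
      refine le_limsup_of_frequently_le (Eventually.frequently ?_)
        (isBoundedUnder_of_eventually_le (tThreshold_div_choose_le_two k d l ε))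
      filter_upwards [h ε hε.2, eventually_ge_atTop (k - d)] with n ⟨H, hH, hdeg, hcov⟩ hn
      rw [le_div_iff₀ (by exact_mod_cast Nat.choose_pos hn)]
      exact hdeg.trans (by exact_mod_cast (minDeg_lt_tThreshold hH hcov).le)
    exact le_limsup_of_frequently_le hev.frequently (isBoundedUnder_of_eventually_le
      (Eventually.of_forall fun ε => limsup_tThreshold_le_two k d l ε))
  · obtain ⟨ε₀, hε₀, h⟩ := exists_kGraph_not_hasYTilingCover (l := l) (by omega) hd hε'
    exact ⟨ε₀, hε₀, fun ε _ hε N => ((eventually_ge_atTop N).and (h ε hε)).exists⟩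
end

section
/- Suppose 1 ≤ ℓ ≤ k/2 and η > 0. There exists n₀ such that the following holds for all n ≥ n₀: if H is a k-graph on n vertices with δ_ℓ(H) ≥ ((1/2)^{(k−ℓ)/ℓ} + η)·C(n, k−ℓ), then for any two disjoint ordered ℓ-sets S and T of vertices of H there exists an ℓ-path of length two in H whose ends are S and T. -/
section Helpers

open Filter Topology Asymptotics

theorem tendsto_choose_floor_mul_div_choose {c : ℝ} (hc : 0 < c) (r : ℕ) :
    Tendsto (fun n : ℕ => (Nat.choose ⌊c * n⌋₊ r : ℝ) / (n.choose r : ℝ)) atTop (𝓝 (c ^ r)) := by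
  have hfloor : Tendsto (fun n : ℕ => ⌊c * (n : ℝ)⌋₊) atTop atTop :=
    tendsto_nat_floor_atTop.comp (tendsto_natCast_atTop_atTop.const_mul_atTop hc)
  have hequiv := ((isEquivalent_choose r).comp_tendsto hfloor).div (isEquivalent_choose r)
  refine hequiv.symm.tendsto_nhds ?_
  have hratio : Tendsto (fun n : ℕ => (⌊c * (n : ℝ)⌋₊ : ℝ) / n) atTop (𝓝 c) :=
    (tendsto_nat_floor_mul_div_atTop hc.le).comp tendsto_natCast_atTop_atTop
  refine (hratio.pow r).congr fun n => ?_
  have : (r.factorial : ℝ) ≠ 0 := by positivity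
  simp only [Pi.div_apply, Function.comp_apply]
  rw [div_div_div_cancel_right₀ this, div_pow]

theorem tendsto_choose_pred_div_choose {m : ℕ} (hm : 1 ≤ m) :
    Tendsto (fun n : ℕ => (n.choose (m - 1) : ℝ) / (n.choose m : ℝ)) atTop (𝓝 0) := by
  have hequiv := (isEquivalent_choose (m - 1)).div (isEquivalent_choose m)
  refine hequiv.symm.tendsto_nhds ?_
  obtain ⟨p, rfl⟩ := Nat.exists_eq_add_of_le' hm
  have := (tendsto_const_nhds (x := ((p : ℝ) + 1))).div_atTop
    (tendsto_natCast_atTop_atTop (R := ℝ))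
  refine this.congr' ?_
  filter_upwards [eventually_gt_atTop 0] with n hn
  have hn' : (n : ℝ) ≠ 0 := by positivity
  have : (p.factorial : ℝ) ≠ 0 := by positivity
  simp only [Pi.div_apply, Nat.add_sub_cancel, Nat.factorial_succ]
  push_cast
  field_simp
  ring

theorem exists_shadow_ratio (m l : ℕ) (hl : 1 ≤ l) {η : ℝ} (hη : 0 < η) :
    ∃ c : ℝ, 0 < c ∧ c < 1 ∧ 1 / 2 < c ^ l ∧ c ^ m < (1 / 2 : ℝ) ^ ((m : ℝ) / l) + η := by
  set c₀ : ℝ := (1 / 2 : ℝ) ^ (1 / (l : ℝ)) with hc₀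
  have hl' : (0 : ℝ) < l := by exact_mod_cast hl
  have hpos : 0 < c₀ := by positivity
  have hlt : c₀ < 1 := Real.rpow_lt_one (by norm_num) (by norm_num) (by positivity)
  have hpow (r : ℕ) : c₀ ^ r = (1 / 2 : ℝ) ^ ((r : ℝ) / l) := by
    rw [hc₀, ← Real.rpow_natCast, ← Real.rpow_mul (by norm_num), one_div_mul_eq_div]
  have hev : ∀ᶠ c in 𝓝[>] c₀, c ^ m < (1 / 2 : ℝ) ^ ((m : ℝ) / l) + η := by
    refine nhdsWithin_le_nhds ((continuous_pow m).continuousAt.eventually_lt_const ?_)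
    simp only [hpow]; linarith
  obtain ⟨c, hcm, hc1, hc⟩ := (hev.and ((Filter.Eventually.filter_mono nhdsWithin_le_nhds
    (eventually_lt_nhds hlt)).and self_mem_nhdsWithin)).exists
  refine ⟨c, hpos.trans hc, hc1, ?_, hcm⟩
  calc (1 / 2 : ℝ) = c₀ ^ l := by rw [hpow, div_self hl'.ne', Real.rpow_one]
    _ < c ^ l := pow_lt_pow_left₀ hc hpos.le (by omega)

/-- `F` extends to a member of `G` whose new part avoids any prescribed set of size `≤ K`. -/
def RobustlyExtends {α : Type*} [DecidableEq α] (G : Finset (Finset α)) (K : ℕ)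
    (F : Finset α) : Prop :=
  ∀ W : Finset α, W.card ≤ K → ∃ E ∈ G, F ⊆ E ∧ Disjoint (E \ F) W

open Classical in
/-- Few members of an `m`-uniform family contain a non-robust `l`-set. -/
theorem card_filter_not_robust_le {α : Type*} [Fintype α] {G : Finset (Finset α)} {m : ℕ}
    (hG : ∀ E ∈ G, E.card = m) (l K : ℕ) :
    (G.filter fun E => ∃ F ⊆ E, F.card = l ∧ ¬ RobustlyExtends G K F).card ≤
      (Fintype.card α).choose (m - 1) * ((m - 1).choose l * K) := by
  have hW : ∀ F : Finset α, ∃ W : Finset α, W.card ≤ K ∧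
      (¬ RobustlyExtends G K F → ∀ E ∈ G, F ⊆ E → ¬ Disjoint (E \ F) W) := by
    intro F
    by_cases h : RobustlyExtends G K F
    · exact ⟨∅, by simp, fun h' => absurd h h'⟩
    · have h' := h
      unfold RobustlyExtends at h'
      push Not at h'
      obtain ⟨W, hWK, hWG⟩ := h'
      exact ⟨W, hWK, fun _ => hWG⟩
  choose W hWK hWG using hW
  have hsub : (G.filter fun E => ∃ F ⊆ E, F.card = l ∧ ¬ RobustlyExtends G K F) ⊆
      (Finset.powersetCard (m - 1) (Finset.univ : Finset α)).biUnion fun E' =>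
        (Finset.powersetCard l E').biUnion fun F => (W F).image fun w => insert w E' := by
    intro E hE
    obtain ⟨hEG, F, hFE, hFl, hF⟩ := Finset.mem_filter.1 hE
    obtain ⟨w, hwEF, hwW⟩ := Finset.not_disjoint_iff.1 (hWG F hF E hEG hFE)
    obtain ⟨hwE, hwF⟩ := Finset.mem_sdiff.1 hwEF
    simp only [Finset.mem_biUnion, Finset.mem_powersetCard, Finset.mem_image]
    refine ⟨E.erase w, ⟨Finset.subset_univ _, ?_⟩, F,
      ⟨Finset.subset_erase.2 ⟨hFE, hwF⟩, hFl⟩, w, hwW, Finset.insert_erase hwE⟩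
    rw [Finset.card_erase_of_mem hwE, hG E hEG]
  refine (Finset.card_le_card hsub).trans ?_
  rw [← Finset.card_univ, ← Finset.card_powersetCard]
  refine Finset.card_biUnion_le_card_mul _ _ _ fun E' hE' => ?_
  rw [← (Finset.mem_powersetCard.1 hE').2, ← Finset.card_powersetCard]
  exact Finset.card_biUnion_le_card_mul _ _ _ fun F _ =>
    Finset.card_image_le.trans (hWK F)

open Classical in
/-- A dense `m`-uniform family has a robust `l`-shadow of density more than one half. -/
theorem eventually_half_lt_card_robust {m l : ℕ} (hl : 1 ≤ l) (hlm : l ≤ m) (K : ℕ)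
    {η : ℝ} (hη : 0 < η) :
    ∀ᶠ n : ℕ in atTop, ∀ G : Finset (Finset (Fin n)), (∀ E ∈ G, E.card = m) →
      ((1 / 2 : ℝ) ^ ((m : ℝ) / l) + η) * (n.choose m : ℝ) ≤ (G.card : ℝ) →
      n.choose l < 2 * ((Finset.powersetCard l Finset.univ).filter
        fun F => RobustlyExtends G K F).card := by
  obtain ⟨c, hc0, hc1, hcl, hcm⟩ := exists_shadow_ratio m l hl hη
  have hshadow := (tendsto_choose_floor_mul_div_choose hc0 l).eventually_const_lt hcl
  have hedges := ((tendsto_choose_floor_mul_div_choose hc0 m).add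
    ((tendsto_choose_pred_div_choose (hl.trans hlm)).mul_const
      (((m - 1).choose l * K : ℕ) : ℝ))).eventually_lt_const
      (show _ < (1 / 2 : ℝ) ^ ((m : ℝ) / l) + η by simpa using hcm)
  have hfloor : Tendsto (fun n : ℕ => ⌊c * (n : ℝ)⌋₊) atTop atTop :=
    tendsto_nat_floor_atTop.comp (tendsto_natCast_atTop_atTop.const_mul_atTop hc0)
  filter_upwards [hshadow, hedges, hfloor.eventually_ge_atTop m, eventually_ge_atTop m]
    with n hshadow hedges hmx hmn G hG hGcard
  set x := ⌊c * (n : ℝ)⌋₊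
  have hxn : x ≤ n := Nat.floor_le_of_le (mul_le_of_le_one_left n.cast_nonneg hc1.le)
  have hnl : (0 : ℝ) < n.choose l := by exact_mod_cast Nat.choose_pos (hlm.trans hmn)
  have hnm : (0 : ℝ) < n.choose m := by exact_mod_cast Nat.choose_pos hmn
  rw [lt_div_iff₀ hnl] at hshadow
  have hedges' : (x.choose m : ℝ) + n.choose (m - 1) * ((m - 1).choose l * K : ℕ) ≤ G.card := by
    refine le_trans (le_of_eq ?_) ((mul_le_mul_of_nonneg_right hedges.le hnm.le).trans hGcard)
    field_simp
  set R := G.filter fun E => ∃ F ⊆ E, F.card = l ∧ ¬ RobustlyExtends G K F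
  have hremoved : R.card ≤ n.choose (m - 1) * ((m - 1).choose l * K) := by
    convert card_filter_not_robust_le hG l K
    exact (Fintype.card_fin n).symm
  have hsplit : (G \ R).card + R.card = G.card :=
    Finset.card_sdiff_add_card_eq_card (Finset.filter_subset _ _)
  have hG' : x.choose m ≤ (G \ R).card := by
    have : x.choose m + n.choose (m - 1) * ((m - 1).choose l * K) ≤ G.card := by
      exact_mod_cast hedges'
    omega
  have hsized : ((G \ R : Finset _) : Set (Finset (Fin n))).Sized m := fun E hE =>
    hG E (Finset.mem_sdiff.1 hE).1
  have hKK := Finset.kruskal_katona_lovasz_form (i := m - l) (Nat.sub_le m l) hmx hxn hsized hG'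
  rw [Nat.sub_sub_self hlm] at hKK
  have hsub : Finset.shadow^[m - l] (G \ R) ⊆ (Finset.powersetCard l Finset.univ).filter
      fun F => RobustlyExtends G K F := by
    intro F hF
    obtain ⟨E, hE, hFE, hcard⟩ := Finset.mem_shadow_iterate_iff_exists_mem_card_add.1 hF
    rw [hsized hE] at hcard
    have hFl : F.card = l := by omega
    simp only [Finset.mem_filter, Finset.mem_powersetCard, Finset.subset_univ, true_and]
    refine ⟨hFl, ?_⟩
    by_contra h
    exact (Finset.mem_sdiff.1 hE).2 (Finset.mem_filter.2
      ⟨(Finset.mem_sdiff.1 hE).1, F, hFE, hFl, h⟩)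
  have hfin : x.choose l ≤ _ := hKK.trans (Finset.card_le_card hsub)
  have : n.choose l < 2 * x.choose l := by
    have : (n.choose l : ℝ) < 2 * x.choose l := by linarith
    exact_mod_cast this
  omega

theorem image_range_getD_append {α : Type*} [DecidableEq α] (X Y Z : List α) (d : α) :
    (Finset.range Y.length).image (fun i => (X ++ (Y ++ Z)).getD (X.length + i) d) =
      Y.toFinset := by
  ext a
  simp only [Finset.mem_image, Finset.mem_range, List.mem_toFinset, List.mem_iff_getElem]
  have hget (i : ℕ) (hi : i < Y.length) : (X ++ (Y ++ Z)).getD (X.length + i) d = Y[i] := by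
    rw [List.getD_append_right _ _ _ _ (Nat.le_add_right _ _), Nat.add_sub_cancel_left,
      List.getD_append _ _ _ _ hi, List.getD_eq_getElem _ _ hi]
  constructor
  · rintro ⟨i, hi, rfl⟩
    exact ⟨i, hi, (hget i hi).symm⟩
  · rintro ⟨i, hi, rfl⟩
    exact ⟨i, hi, hget i hi⟩

theorem exists_isLPath_two {n k l : ℕ} (hl : 1 ≤ l) {H : Finset (Finset (Fin n))}
    {S T : Fin l → Fin n} (hS : Function.Injective S) (hT : Function.Injective T)
    {A M B : Finset (Fin n)} (hA : A.card + 2 * l = k) (hM : M.card = l) (hB : B.card + 2 * l = k)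
    (hST : Disjoint (Finset.univ.image S) (Finset.univ.image T))
    (hSA : Disjoint (Finset.univ.image S) A) (hSM : Disjoint (Finset.univ.image S) M)
    (hSB : Disjoint (Finset.univ.image S) B) (hTA : Disjoint (Finset.univ.image T) A)
    (hTM : Disjoint (Finset.univ.image T) M) (hTB : Disjoint (Finset.univ.image T) B)
    (hAM : Disjoint A M) (hAB : Disjoint A B) (hMB : Disjoint M B)
    (h₁ : Finset.univ.image S ∪ (A ∪ M) ∈ H) (h₂ : Finset.univ.image T ∪ (M ∪ B) ∈ H) :
    ∃ f : ℕ → Fin n, IsLPath n k l 2 H f ∧ pathBeg n l f = S ∧ pathEnd n k l 2 f = T := by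
  set d : Fin n := S ⟨0, hl⟩
  set s := List.ofFn S
  set t := List.ofFn T
  have hs : s.length = l := List.length_ofFn
  have ht : t.length = l := List.length_ofFn
  have hsS : s.toFinset = Finset.univ.image S := by ext; simp [s, List.mem_ofFn]
  have htT : t.toFinset = Finset.univ.image T := by ext; simp [t, List.mem_ofFn]
  set L := s ++ (A.toList ++ (M.toList ++ (B.toList ++ t)))
  have hL : L.length = 2 * (k - l) + l := by
    simp only [L, List.length_append, Finset.length_toList, hs, ht]; omega
  have hnodup : L.Nodup := by
    have memS {x} : x ∈ s ↔ x ∈ Finset.univ.image S := by rw [← hsS, List.mem_toFinset]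
    have memT {x} : x ∈ t ↔ x ∈ Finset.univ.image T := by rw [← htT, List.mem_toFinset]
    rw [Finset.disjoint_left] at *
    simp only [L, List.nodup_append', Finset.nodup_toList, true_and, List.disjoint_left,
      List.mem_append, Finset.mem_toList, memS, memT, s, t, List.nodup_ofFn, hS, hT]
    grind
  refine ⟨fun i => L.getD i d, ⟨?_, ?_⟩, ?_, ?_⟩
  · intro i hi j hj hij
    rw [Set.mem_Iio, ← hL] at hi hj
    simp only [List.getD_eq_getElem _ _ hi, List.getD_eq_getElem _ _ hj] at hij
    exact hnodup.getElem_inj_iff.1 hij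
  · intro j hj
    interval_cases j
    · convert h₁ using 1
      have := image_range_getD_append [] (s ++ (A.toList ++ M.toList)) (B.toList ++ t) d
      simp only [List.length_append, Finset.length_toList, hs, hM, List.toFinset_append, hsS,
        Finset.toList_toFinset, List.length_nil, List.nil_append, List.append_assoc] at this
      rw [← this, show l + (A.card + l) = k by omega, zero_mul]
    · convert h₂ using 1
      have := image_range_getD_append (s ++ A.toList) (M.toList ++ (B.toList ++ t)) [] d
      simp only [List.length_append, Finset.length_toList, hs, ht, hM, List.toFinset_append, htT,
        Finset.toList_toFinset, List.append_nil, List.append_assoc] at this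
      rw [Finset.union_comm, Finset.union_assoc, ← this, show l + (B.card + l) = k by omega,
        one_mul, show l + A.card = k - l by omega]
  · funext i
    have hi : (i : ℕ) < s.length := i.isLt.trans_eq hs.symm
    simp only [pathBeg, L]
    rw [List.getD_append _ _ _ _ hi, List.getD_eq_getElem _ _ hi]
    simp [s]
  · funext i
    have hassoc : L = (s ++ A.toList ++ M.toList ++ B.toList) ++ t := by
      simp only [L, List.append_assoc]
    have hlen : (s ++ A.toList ++ M.toList ++ B.toList).length = 2 * (k - l) := by
      simp only [List.length_append, Finset.length_toList, hs]; omega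
    have hi : (i : ℕ) < t.length := i.isLt.trans_eq ht.symm
    simp only [pathEnd, hassoc]
    rw [← hlen, List.getD_append_right _ _ _ _ (Nat.le_add_right _ _), Nat.add_sub_cancel_left,
      List.getD_eq_getElem _ _ hi]
    simp [t]

/-- The link of a vertex set `X` in the `k`-graph `H`. -/
noncomputable def hLink (n k : ℕ) (H : Finset (Finset (Fin n))) (X : Finset (Fin n)) :
    Finset (Finset (Fin n)) :=
  Finset.univ.filter fun E => E.card = k - X.card ∧ Disjoint X E ∧ X ∪ E ∈ H

theorem minDeg_le_card_hLink {n k d : ℕ} (H : Finset (Finset (Fin n))) {X : Finset (Fin n)}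
    (hX : X.card = d) : minDeg n k d H ≤ (hLink n k H X).card := by
  have hle : minDeg n k d H ≤ hDeg n k H X := Nat.sInf_le ⟨X, hX, rfl⟩
  refine hle.trans (le_of_eq ?_)
  exact Nat.subtype_card _ fun E => by simp [hLink]

end Helpers

/-- **Connecting lemma.** For `1 ≤ ℓ ≤ k/2` and `η > 0`, in every
sufficiently large `k`-graph `H` with `δ_ℓ(H) ≥ ((1/2)^{(k-ℓ)/ℓ} + η) C(n, k-ℓ)`, any two
disjoint ordered `ℓ`-sets `S`, `T` are the ends of an `ℓ`-path of length two in `H`. -/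
theorem connecting_lemma (k l : ℕ) (hl1 : 1 ≤ l) (hlk : 2 * l ≤ k) (η : ℝ) (hη : 0 < η) :
    ∃ n₀ : ℕ, ∀ n : ℕ, n₀ ≤ n →
      ∀ H : Finset (Finset (Fin n)), IsKGraph n k H →
        (((1 : ℝ) / 2) ^ (((k : ℝ) - (l : ℝ)) / (l : ℝ)) + η) * (n.choose (k - l) : ℝ) ≤
          (minDeg n k l H : ℝ) →
        ∀ S T : Fin l → Fin n, Function.Injective S → Function.Injective T →
          (∀ i j, S i ≠ T j) →
          ∃ f : ℕ → Fin n, IsLPath n k l 2 H f ∧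
            pathBeg n l f = S ∧ pathEnd n k l 2 f = T := by
  have hkl : (k : ℝ) - l = ((k - l : ℕ) : ℝ) := by rw [Nat.cast_sub (by omega)]
  obtain ⟨n₀, hn₀⟩ := Filter.eventually_atTop.1
    (eventually_half_lt_card_robust hl1 (show l ≤ k - l by omega) k hη)
  refine ⟨n₀, fun n hn H _ hdeg S T hS hT hST => ?_⟩
  rw [hkl] at hdeg
  have hcard {X : Fin l → Fin n} (hX : Function.Injective X) :
      (Finset.univ.image X).card = l := by
    rw [Finset.card_image_of_injective _ hX, Finset.card_univ, Fintype.card_fin]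
  classical
  have hlink {X : Fin l → Fin n} (hX : Function.Injective X) :=
    hn₀ n hn (hLink n k H (Finset.univ.image X))
      (fun E hE => (Finset.mem_filter.1 hE).2.1.trans (by rw [hcard hX]))
      (hdeg.trans (Nat.cast_le.2 (minDeg_le_card_hLink H (hcard hX))))
  obtain ⟨M, hM⟩ := Finset.inter_nonempty_of_card_lt_card_add_card
    (Finset.filter_subset
      (fun F => RobustlyExtends (hLink n k H (Finset.univ.image S)) k F)
      (Finset.powersetCard l Finset.univ))
    (Finset.filter_subset
      (fun F => RobustlyExtends (hLink n k H (Finset.univ.image T)) k F)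
      (Finset.powersetCard l Finset.univ)) (by
      have h₁ := hlink hS
      have h₂ := hlink hT
      rw [Finset.card_powersetCard, Finset.card_univ, Fintype.card_fin]
      grind)
  obtain ⟨hMS, hMT⟩ := Finset.mem_inter.1 hM
  obtain ⟨hMl, hMS⟩ := Finset.mem_filter.1 hMS
  have hMT := (Finset.mem_filter.1 hMT).2
  have hMl := (Finset.mem_powersetCard.1 hMl).2
  obtain ⟨E₁, hE₁, hME₁, hE₁T⟩ := hMS (Finset.univ.image T) (by rw [hcard hT]; omega)
  obtain ⟨hE₁c, hE₁S, hE₁H⟩ := (Finset.mem_filter.1 hE₁).2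
  rw [hcard hS] at hE₁c
  have hAc := Finset.card_sdiff_add_card_eq_card hME₁
  obtain ⟨E₂, hE₂, hME₂, hE₂W⟩ := hMT (Finset.univ.image S ∪ E₁ \ M)
    ((Finset.card_union_le _ _).trans (by rw [hcard hS]; omega))
  obtain ⟨hE₂c, hE₂T, hE₂H⟩ := (Finset.mem_filter.1 hE₂).2
  rw [hcard hT] at hE₂c
  have hBc := Finset.card_sdiff_add_card_eq_card hME₂
  obtain ⟨hBS, hBA⟩ := Finset.disjoint_union_right.1 hE₂W
  refine exists_isLPath_two hl1 hS hT (A := E₁ \ M) (M := M) (B := E₂ \ M) (by omega) hMl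
    (by omega) ?_ (hE₁S.mono_right Finset.sdiff_subset) (hE₁S.mono_right hME₁) hBS.symm
    hE₁T.symm (hE₂T.mono_right hME₂) (hE₂T.mono_right Finset.sdiff_subset)
    Finset.sdiff_disjoint hBA.symm Finset.disjoint_sdiff ?_ ?_
  · rw [Finset.disjoint_left]
    simpa using fun i j => (hST i j).symm
  · rwa [Finset.sdiff_union_of_subset hME₁]
  · rwa [Finset.union_sdiff_of_subset hME₂]
end
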